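/- Let l ≥ 3 and let b, c ∈ S_l with b_l = c_l. Define B_3(b;c) = ∑_{d_1 = b_1}^{b_2 - 1} ⋯ ∑_{d_{l-1} = b_{l-1}}^{b_l - 1} A(d_1,…,d_{l-1}; c_1,…,c_{l-1}) (1-t)^{∑_{i=1}^{l-1}(c_i - d_i)}. Then B_3(b;c) = B_1(b;c), where B_1(b;c) = ∑_{d ∈ S_l} A(d;c) {d;b} (1-t)^{∑(c_i - d_i)}. -/

import Mathlib

open Polynomial Finset

/-- Bracket symbol: `t` if `c > b`, `1` if `c = b`, `0` if `c < b` (here `t = X ∈ ℚ[t]`). -/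
noncomputable def brk (c b : ℕ) : Polynomial ℚ :=
  if b < c then X else if c = b then 1 else 0

/-- Antisymmetrized tuple bracket `{c; b} = ∑_σ sign(σ) ∏ᵢ [c_{σ(i)}, bᵢ]`. -/
noncomputable def braceT {l : ℕ} (c b : Fin l → ℕ) : Polynomial ℚ :=
  ∑ σ : Equiv.Perm (Fin l), (Equiv.Perm.sign σ : ℤ) • ∏ i, brk (c (σ i)) (b i)

/-- The recursively defined coefficient `A(b; c)`:  for `l = 2`, `A = 1` iff `b₂ = c₂` and
`b₁ ≤ c₁`; for `l > 2`, `A(b;c) = 0` if the last entries differ, and otherwise it is the sum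
of `A` on the truncations over all strictly increasing `(l-1)`-tuples `c'` of positive
integers with `c' ≤ (c₁, …, c_{l-1})` componentwise. -/
def Acoef : (l : ℕ) → (Fin l → ℕ) → (Fin l → ℕ) → ℕ
  | 0, _, _ => 0
  | 1, _, _ => 0
  | 2, b, c => if b 1 = c 1 ∧ b 0 ≤ c 0 then 1 else 0
  | l + 3, b, c =>
    if b (Fin.last (l + 2)) = c (Fin.last (l + 2)) then
      ∑ c' ∈ (Finset.Icc (fun _ => 1) (fun j : Fin (l + 2) => c j.castSucc)).filter
          (fun c' => ∀ i j : Fin (l + 2), i < j → c' i < c' j),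
        Acoef (l + 2) (fun j => b j.castSucc) c'
    else 0

/-- `B₃(b;c) = ∑_{d₁=b₁}^{b₂-1} ⋯ ∑_{d_{l-1}=b_{l-1}}^{b_l-1}
A(d₁,…,d_{l-1}; c₁,…,c_{l-1}) (1-t)^{∑_{i=1}^{l-1}(cᵢ-dᵢ)}`, for `l = m + 3`. -/
noncomputable def B3fn (m : ℕ) (b c : Fin (m + 3) → ℕ) : Polynomial ℚ :=
  ∑ d ∈ Finset.Icc (fun j : Fin (m + 2) => b j.castSucc)
      (fun j : Fin (m + 2) => b j.succ - 1),
    (Acoef (m + 2) d (fun j => c j.castSucc) : Polynomial ℚ) *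
      (1 - X) ^ (∑ j, (c j.castSucc - d j))

/-- strictly increasing positive tuples below `c` -/
def TT {n : ℕ} (c : Fin n → ℕ) : Finset (Fin n → ℕ) :=
  (Finset.Icc (fun _ => 1) c).filter (fun d => ∀ i j : Fin n, i < j → d i < d j)

theorem mem_TT {n : ℕ} {c d : Fin n → ℕ} :
    d ∈ TT c ↔ (∀ i, 1 ≤ d i) ∧ (∀ i, d i ≤ c i) ∧ StrictMono d := by
  simp only [TT, Finset.mem_filter, Finset.mem_Icc, Pi.le_def, and_assoc]
  rfl

/-- summation operator -/
def SS {V : Type*} [AddCommGroup V] (v : ℕ → V) (k : ℕ) : V := ∑ x ∈ Finset.Icc 1 k, v x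

/-- fix the last argument of an alternating map -/
def fixLast {R V : Type*} [CommRing R] [AddCommGroup V] [Module R V] {n : ℕ}
    (F : V [⋀^Fin (n + 1)]→ₗ[R] R) (x : V) : V [⋀^Fin n]→ₗ[R] R where
  toFun m := F (Fin.snoc (α := fun _ => V) m x)
  map_update_add' := by
    intro inst m i a b
    have := Subsingleton.elim inst (fun a b => instDecidableEqFin n a b)
    subst this
    simp only [Fin.snoc_update, F.map_update_add]
  map_update_smul' := by
    intro inst m i a b
    have := Subsingleton.elim inst (fun a b => instDecidableEqFin n a b)
    subst this
    simp only [Fin.snoc_update, F.map_update_smul]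
  map_eq_zero_of_eq' := by
    intro v i j h hij
    apply F.map_eq_zero_of_eq (i := i.castSucc) (j := j.castSucc)
    · simpa using h
    · simpa using hij

theorem fixLast_apply {R V : Type*} [CommRing R] [AddCommGroup V] [Module R V] {n : ℕ}
    (F : V [⋀^Fin (n + 1)]→ₗ[R] R) (x : V) (m : Fin n → V) :
    fixLast F x m = F (Fin.snoc (α := fun _ => V) m x) := rfl

theorem sum_TT_snoc {M : Type*} [AddCommMonoid M] {n : ℕ} (c : Fin (n + 1) → ℕ)
    (f : (Fin (n + 1) → ℕ) → M) :
    ∑ d ∈ TT c, f d = ∑ d ∈ TT (fun j : Fin n => c j.castSucc),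
      ∑ x ∈ (Finset.Icc 1 (c (Fin.last n))).filter (fun x => ∀ i, d i < x),
        f (Fin.snoc (α := fun _ => ℕ) d x) := by
  rw [Finset.sum_sigma']
  refine Finset.sum_bij' (fun d _ => ⟨fun j => d j.castSucc, d (Fin.last n)⟩)
    (fun p _ => Fin.snoc (α := fun _ => ℕ) p.1 p.2) ?_ ?_ ?_ ?_ ?_
  · intro d hd
    rw [mem_TT] at hd
    obtain ⟨h1, h2, h3⟩ := hd
    simp only [Finset.mem_sigma, mem_TT, Finset.mem_filter, Finset.mem_Icc]
    refine ⟨⟨fun i => h1 _, fun i => h2 _, fun i j h => h3 (by simpa using h)⟩,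
      ⟨h1 _, h2 _⟩, fun i => h3 (Fin.castSucc_lt_last i)⟩
  · rintro ⟨d, x⟩ hd
    simp only [Finset.mem_sigma, mem_TT, Finset.mem_filter, Finset.mem_Icc] at hd
    obtain ⟨⟨h1, h2, h3⟩, ⟨h4, h5⟩, h6⟩ := hd
    rw [mem_TT]
    refine ⟨?_, ?_, ?_⟩
    · intro i
      refine Fin.lastCases ?_ (fun i => ?_) i <;> simp [*]
    · intro i
      refine Fin.lastCases ?_ (fun i => ?_) i <;> simp [*]
    · intro i j
      refine Fin.lastCases ?_ (fun j => ?_) j <;> refine Fin.lastCases ?_ (fun i => ?_) i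
      · simp
      · simp [h6]
      · intro h
        exact absurd h (not_lt.mpr (Fin.le_last _))
      · intro h
        simpa using h3 (by simpa using h)
  · intro d _
    funext i
    refine Fin.lastCases ?_ (fun i => ?_) i <;> simp
  · rintro ⟨d, x⟩ _
    simp
  · intro d _
    congr 1
    funext i
    refine Fin.lastCases ?_ (fun i => ?_) i <;> simp

theorem fixLast_sum {R V : Type*} [CommRing R] [AddCommGroup V] [Module R V] {n : ℕ}
    (F : V [⋀^Fin (n + 1)]→ₗ[R] R) (s : Finset ℕ) (v : ℕ → V) (m : Fin n → V) :
    fixLast F (∑ x ∈ s, v x) m = ∑ x ∈ s, fixLast F (v x) m := by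
  have h : ∀ x : V, fixLast F x m =
      F (Function.update (Fin.snoc (α := fun _ => V) m 0) (Fin.last n) x) := by
    intro x
    rw [fixLast_apply, Fin.update_snoc_last]
  simp only [h]
  rw [F.map_update_sum]

theorem fixLast_sub {R V : Type*} [CommRing R] [AddCommGroup V] [Module R V] {n : ℕ}
    (F : V [⋀^Fin (n + 1)]→ₗ[R] R) (a b : V) (m : Fin n → V) :
    fixLast F (a - b) m = fixLast F a m - fixLast F b m := by
  have h : ∀ x : V, fixLast F x m =
      F (Function.update (Fin.snoc (α := fun _ => V) m 0) (Fin.last n) x) := by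
    intro x
    rw [fixLast_apply, Fin.update_snoc_last]
  simp only [h]
  rw [F.map_update_sub]

theorem SS_split {V : Type*} [AddCommGroup V] (v : ℕ → V) (a k : ℕ) (h : a ≤ k) :
    ∑ x ∈ Finset.Icc (a + 1) k, v x = SS v k - SS v a := by
  rw [eq_sub_iff_add_eq, SS, SS, add_comm]
  have e : ∀ p q, Finset.Icc (p + 1) q = Finset.Ioc p q := fun p q => by
    ext; simp
  rw [e, show (1 : ℕ) = 0 + 1 from rfl, e, e]
  exact Finset.sum_Ioc_consecutive v (Nat.zero_le _) h

theorem Qlem {R V : Type*} [CommRing R] [AddCommGroup V] [Module R V] (n : ℕ) :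
    ∀ (F : V [⋀^Fin n]→ₗ[R] R) (v : ℕ → V) (c : Fin n → ℕ), StrictMono c →
    ∑ d ∈ TT c, F (fun j => SS^[(Fin.rev j : ℕ)] v (d j)) =
      F (fun j => SS^[(Fin.rev j : ℕ) + 1] v (c j)) := by
  induction n with
  | zero =>
    intro F v c hc
    have : TT c = {c} := by
      ext d
      simp [mem_TT, Subsingleton.elim d c, Subsingleton.strictMono]
    rw [this, Finset.sum_singleton]
    congr 1
    exact Subsingleton.elim _ _
  | succ n ih =>
    intro F v c hc
    rw [sum_TT_snoc]
    have hR : F (fun j => SS^[(Fin.rev j : ℕ) + 1] v (c j)) =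
        fixLast F (SS v (c (Fin.last n)))
          (fun j => SS^[(Fin.rev j : ℕ) + 1] (SS v) (c j.castSucc)) := by
      rw [fixLast_apply]
      congr 1
      funext j
      refine Fin.lastCases ?_ (fun j => ?_) j
      · simp
      · simp [Fin.rev_castSucc]
    rw [hR, ← ih _ _ _ (fun i j h => hc (by simpa using h))]
    apply Finset.sum_congr rfl
    intro d hd
    rw [mem_TT] at hd
    obtain ⟨h1, h2, h3⟩ := hd
    have hL : ∀ x, F (fun j => SS^[(Fin.rev j : ℕ)] v
        (Fin.snoc (α := fun _ => ℕ) d x j)) =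
        fixLast F (v x) (fun j => SS^[(Fin.rev j : ℕ)] (SS v) (d j)) := by
      intro x
      rw [fixLast_apply]
      congr 1
      funext j
      refine Fin.lastCases ?_ (fun j => ?_) j
      · simp
      · simp [Fin.rev_castSucc]
    simp only [hL]
    rw [← fixLast_sum]
    cases n with
    | zero => simp [SS]
    | succ p =>
      have : (Finset.Icc 1 (c (Fin.last (p + 1)))).filter (fun x => ∀ i, d i < x) =
          Finset.Icc (d (Fin.last p) + 1) (c (Fin.last (p + 1))) := by
        ext x
        simp only [Finset.mem_filter, Finset.mem_Icc]
        constructor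
        · rintro ⟨⟨_, h⟩, h'⟩
          exact ⟨h' _, h⟩
        · rintro ⟨h, h'⟩
          refine ⟨⟨by omega, h'⟩, fun i => ?_⟩
          have := h3.monotone (Fin.le_last i)
          omega
      rw [this, SS_split, fixLast_sub, sub_eq_self]
      · rw [fixLast_apply]
        apply F.map_eq_zero_of_eq (i := (Fin.last p).castSucc) (j := Fin.last (p + 1))
        · simp
        · exact (Fin.castSucc_lt_last _).ne
      · exact (h2 _).trans (hc.monotone (Fin.le_last _))

theorem Acoef_succ (l : ℕ) (b c : Fin (l + 3) → ℕ) : Acoef (l + 3) b c =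
    if b (Fin.last (l + 2)) = c (Fin.last (l + 2)) then
      ∑ c' ∈ TT (fun j : Fin (l + 2) => c j.castSucc),
        Acoef (l + 2) (fun j => b j.castSucc) c'
    else 0 := rfl

theorem Acoef_last (l : ℕ) (b c : Fin (l + 2) → ℕ) (h : Acoef (l + 2) b c ≠ 0) :
    b (Fin.last _) = c (Fin.last _) := by
  cases l with
  | zero =>
    simp only [Acoef] at h
    by_contra h'
    apply h
    rw [if_neg]
    rintro ⟨h1, _⟩
    exact h' h1
  | succ l =>
    rw [Acoef_succ] at h
    by_contra h'
    exact h (if_neg h')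

theorem Acoef_le (l : ℕ) : ∀ (b c : Fin (l + 2) → ℕ), Acoef (l + 2) b c ≠ 0 →
    ∀ j, b j ≤ c j := by
  induction l with
  | zero =>
    intro b c h j
    simp only [Acoef, ne_eq, ite_eq_right_iff, one_ne_zero, imp_false, not_not] at h
    fin_cases j
    · exact h.2
    · exact h.1.le
  | succ l ih =>
    intro b c h j
    have hl := Acoef_last _ _ _ h
    rw [Acoef_succ, if_pos hl] at h
    obtain ⟨c', hc', h'⟩ := Finset.exists_ne_zero_of_sum_ne_zero h
    rw [mem_TT] at hc'
    refine Fin.lastCases hl.le (fun j => ?_) j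
    exact (ih _ _ h' j).trans (hc'.2.1 j)

theorem Klem {R V : Type*} [CommRing R] [AddCommGroup V] [Module R V] (n : ℕ) :
    ∀ (F : V [⋀^Fin (n + 2)]→ₗ[R] R) (v : ℕ → V) (c : Fin (n + 2) → ℕ), StrictMono c →
    (∀ i, 1 ≤ c i) →
    ∑ d ∈ TT c, (Acoef (n + 2) d c : R) * F (fun j => v (d j)) =
      F (fun j => SS^[(Fin.rev j : ℕ)] v (c j)) := by
  induction n with
  | zero =>
    intro F v c hc hc1
    have hR : F (fun j => SS^[(Fin.rev j : ℕ)] v (c j)) =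
        fixLast F (v (c (Fin.last 1)))
          (fun j => SS^[(Fin.rev j : ℕ) + 1] v (c j.castSucc)) := by
      rw [fixLast_apply]
      congr 1
      funext j
      refine Fin.lastCases ?_ (fun j => ?_) j
      · rw [Fin.snoc_last, Fin.rev_last]
        rfl
      · rw [Fin.snoc_castSucc, Fin.rev_castSucc]
        rfl
    rw [hR, ← Qlem _ _ _ _ (fun i j h => hc (by simpa using h)), sum_TT_snoc]
    apply Finset.sum_congr rfl
    intro d hd
    rw [mem_TT] at hd
    rw [Finset.sum_eq_single (c (Fin.last 1))]
    · have : Acoef (0 + 2) (Fin.snoc (α := fun _ => ℕ) d (c (Fin.last 1))) c = 1 := by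
        simp only [Acoef]
        rw [if_pos]
        refine ⟨?_, ?_⟩
        · exact Fin.snoc_last (α := fun _ => ℕ) _ _
        · have := Fin.snoc_castSucc (α := fun _ => ℕ) (c (Fin.last 1)) d 0
          rw [Fin.castSucc_zero] at this
          rw [this]
          exact hd.2.1 0
      rw [this, Nat.cast_one, one_mul, fixLast_apply]
      congr 1
      funext j
      refine Fin.lastCases ?_ (fun j => ?_) j
      · rw [Fin.snoc_last, Fin.snoc_last]
      · have : j = 0 := Subsingleton.elim _ _
        subst this
        simp
    · intro x _ hx
      rw [show Acoef (0 + 2) (Fin.snoc (α := fun _ => ℕ) d x) c = 0 from ?_]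
      · simp
      · by_contra h
        have := Acoef_last _ _ _ h
        rw [Fin.snoc_last] at this
        exact hx this
    · intro h
      exfalso
      apply h
      simp only [Finset.mem_filter, Finset.mem_Icc]
      refine ⟨⟨hc1 _, le_rfl⟩, fun i => ?_⟩
      exact (hd.2.1 i).trans_lt (hc (Fin.castSucc_lt_last i))
  | succ n ih =>
    intro F v c hc hc1
    have hR : F (fun j => SS^[(Fin.rev j : ℕ)] v (c j)) =
        fixLast F (v (c (Fin.last (n + 2))))
          (fun j => SS^[(Fin.rev j : ℕ) + 1] v (c j.castSucc)) := by
      rw [fixLast_apply]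
      congr 1
      funext j
      refine Fin.lastCases ?_ (fun j => ?_) j
      · rw [Fin.snoc_last, Fin.rev_last]
        rfl
      · rw [Fin.snoc_castSucc, Fin.rev_castSucc]
        rfl
    rw [hR, ← Qlem _ _ _ _ (fun i j h => hc (by simpa using h)), sum_TT_snoc]
    have step : ∀ c' ∈ TT (fun j : Fin (n + 2) => c j.castSucc),
        fixLast F (v (c (Fin.last (n + 2)))) (fun j => SS^[(Fin.rev j : ℕ)] v (c' j)) =
        ∑ d ∈ TT (fun j : Fin (n + 2) => c j.castSucc), (Acoef (n + 2) d c' : R) *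
          fixLast F (v (c (Fin.last (n + 2)))) (fun j => v (d j)) := by
      intro c' hc'
      rw [mem_TT] at hc'
      rw [← ih _ _ _ hc'.2.2 hc'.1]
      apply Finset.sum_subset
      · intro d hd
        rw [mem_TT] at hd ⊢
        exact ⟨hd.1, fun i => (hd.2.1 i).trans (hc'.2.1 i), hd.2.2⟩
      · intro d hd hd'
        rw [show Acoef (n + 2) d c' = 0 from ?_]
        · simp
        · by_contra h
          rw [mem_TT] at hd hd'
          exact hd' ⟨hd.1, Acoef_le _ _ _ h, hd.2.2⟩
    rw [Finset.sum_congr rfl step, Finset.sum_comm]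
    apply Finset.sum_congr rfl
    intro d hd
    rw [mem_TT] at hd
    rw [Finset.sum_eq_single (c (Fin.last (n + 2)))]
    · rw [← Finset.sum_mul, Acoef_succ, if_pos (by rw [Fin.snoc_last])]
      simp only [Fin.snoc_castSucc]
      push_cast
      congr 1
      rw [fixLast_apply]
      congr 1
      funext j
      refine Fin.lastCases ?_ (fun j => ?_) j
      · simp
      · simp
    · intro x _ hx
      rw [show Acoef (n + 1 + 2) (Fin.snoc (α := fun _ => ℕ) d x) c = 0 from ?_]
      · simp
      · by_contra h
        have := Acoef_last _ _ _ h
        rw [Fin.snoc_last] at this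
        exact hx this
    · intro h
      exfalso
      apply h
      simp only [Finset.mem_filter, Finset.mem_Icc]
      refine ⟨⟨hc1 _, le_rfl⟩, fun i => ?_⟩
      exact (hd.2.1 i).trans_lt (hc (Fin.castSucc_lt_last i))

theorem SS_iter_congr {V : Type*} [AddCommGroup V] (r : ℕ) : ∀ (f g : ℕ → V) (N : ℕ),
    (∀ k ≤ N, f k = g k) → ∀ k ≤ N, SS^[r] f k = SS^[r] g k := by
  induction r with
  | zero => intro f g N h; simpa using h
  | succ r ih =>
    intro f g N h
    simp only [Function.iterate_succ, Function.comp]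
    apply ih
    intro k hk
    apply Finset.sum_congr rfl
    intro x hx
    exact h x ((Finset.mem_Icc.mp hx).2.trans hk)

theorem SS_iter_zero {V : Type*} [AddCommGroup V] (r : ℕ) (k : ℕ) :
    SS^[r] (fun _ => (0 : V)) k = 0 := by
  have h : SS (fun _ => (0 : V)) = fun _ => 0 := by
    funext k; simp [SS]
  rw [Function.iterate_fixed h]

theorem SS_iter_apply {V : Type*} [AddCommGroup V] {n : ℕ} (r : ℕ) :
    ∀ (v : ℕ → Fin n → V) (k : ℕ) (i : Fin n),
    SS^[r] v k i = SS^[r] (fun k => v k i) k := by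
  induction r with
  | zero => intro v k i; rfl
  | succ r ih =>
    intro v k i
    simp only [Function.iterate_succ, Function.comp]
    rw [ih]
    refine congrArg (fun f : ℕ → V => SS^[r] f k) ?_
    funext k
    simp [SS]

/-- weighted bracket -/
noncomputable def phi (N b k : ℕ) : ℚ[X] := (1 - X) ^ (N - k) * brk k b
/-- weighted step -/
noncomputable def psi (N b k : ℕ) : ℚ[X] := (1 - X) ^ (N - k) * if b ≤ k then 1 else 0

theorem SS_phi (N b : ℕ) (hb : 1 ≤ b) : ∀ k ≤ N, SS (phi N b) k = psi N b k := by
  intro k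
  induction k with
  | zero =>
    intro _
    simp only [SS, psi]
    rw [if_neg (by omega)]
    simp
  | succ k ih =>
    intro hk
    have h1 : SS (phi N b) (k + 1) = SS (phi N b) k + phi N b (k + 1) := by
      simp only [SS]
      rw [Finset.sum_Icc_succ_top (by omega)]
    rw [h1, ih (by omega)]
    simp only [psi, phi, brk]
    have h2 : N - k = N - (k + 1) + 1 := by omega
    rw [h2, pow_succ]
    rcases lt_trichotomy b (k + 1) with h | h | h
    · rw [if_pos (by omega), if_pos h, if_pos (by omega)]; ring
    · rw [if_neg (by omega), if_neg (by omega), if_pos (by omega), if_pos (by omega)]; ring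
    · rw [if_neg (by omega), if_neg (by omega), if_neg (by omega), if_neg (by omega)]; ring

theorem braceT_det {n : ℕ} (d b : Fin n → ℕ) :
    braceT d b = (Matrix.of fun j i => brk (d j) (b i)).det := by
  rw [Matrix.det_apply, braceT]
  rfl

theorem step_det {n : ℕ} (d : Fin (n + 1) → ℕ) (b : Fin (n + 2) → ℕ) (hd : StrictMono d)
    (hb : StrictMono b) (hN : d (Fin.last n) < b (Fin.last (n + 1))) :
    (Matrix.of fun j (i : Fin (n + 1)) => if b i.castSucc ≤ d j then (1 : ℚ[X]) else 0).det =
      if ∀ j, b j.castSucc ≤ d j ∧ d j < b j.succ then 1 else 0 := by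
  split_ifs with h
  · rw [Matrix.det_of_isLowerTriangular]
    · apply Finset.prod_eq_one
      intro j _
      simp [(h j).1]
    · intro j i hij
      have hij : j < i := hij
      have h1 := (h j).2
      have h2 : b j.succ ≤ b i.castSucc := by
        apply hb.monotone
        rw [Fin.le_def]
        simp
        exact hij
      simp only [Matrix.of_apply]
      rw [if_neg (by omega)]
  · by_contra hdet
    apply h
    have key0 : b 0 ≤ d 0 := by
      by_contra h0
      apply hdet
      apply Matrix.det_eq_zero_of_row_eq_zero 0
      intro i
      have := hb.monotone (Fin.zero_le i.castSucc)
      simp only [Matrix.of_apply]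
      rw [if_neg (by omega)]
    have key : ∀ j : Fin n, ∃ i : Fin (n + 1), d j.castSucc < b i.castSucc ∧
        b i.castSucc ≤ d j.succ := by
      intro j
      by_contra hj
      push Not at hj
      apply hdet
      apply Matrix.det_zero_of_row_eq (i := j.castSucc) (j := j.succ)
      · exact (Fin.castSucc_lt_succ).ne
      · funext i
        simp only [Matrix.of_apply]
        have h1 := hj i
        have h2 : d j.castSucc < d j.succ := hd Fin.castSucc_lt_succ
        by_cases h3 : b i.castSucc ≤ d j.castSucc
        · rw [if_pos h3, if_pos (by omega)]
        · rw [if_neg h3, if_neg (by have := h1 (by omega); omega)]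
    have low : ∀ j, b j.castSucc ≤ d j := by
      intro j
      induction j using Fin.induction with
      | zero => simpa using key0
      | succ j ih =>
        obtain ⟨i, h1, h2⟩ := key j
        have h3 : b j.castSucc.castSucc < b i.castSucc := by omega
        have h4 := hb.lt_iff_lt.mp h3
        refine le_trans (hb.monotone ?_) h2
        rw [Fin.lt_def] at h4
        rw [Fin.le_def]
        simpa using h4
    have high : ∀ j, d j < b j.succ := by
      intro j
      induction j using Fin.reverseInduction with
      | last => simpa using hN
      | cast j ih =>
        obtain ⟨i, h1, h2⟩ := key j
        have h3 : b i.castSucc < b j.succ.succ := by omega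
        have h4 := hb.lt_iff_lt.mp h3
        refine lt_of_lt_of_le h1 (hb.monotone ?_)
        rw [Fin.lt_def] at h4
        rw [Fin.le_def]
        simp at h4 ⊢
        omega
    exact fun j => ⟨low j, high j⟩

theorem wprod {n : ℕ} (N : ℕ) (c d : Fin n → ℕ) (h1 : ∀ i, d i ≤ c i) (h2 : ∀ i, c i ≤ N) :
    ((1 - X : ℚ[X]) ^ (∑ i, (N - c i))) * (1 - X) ^ (∑ i, (c i - d i)) =
      ∏ i, (1 - X) ^ (N - d i) := by
  rw [← pow_add, ← Finset.sum_add_distrib, Finset.prod_pow_eq_pow_sum]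
  congr 1
  apply Finset.sum_congr rfl
  intro i _
  have := h1 i
  have := h2 i
  omega

/-- Theorem 3.1, second part: for `l = m + 3 ≥ 3` and strictly increasing tuples `b, c` of
positive integers with equal last entries, `B₃(b;c) = B₁(b;c)`, where
`B₁(b;c) = ∑_{d ∈ S_l} A(d;c) {d;b} (1-t)^{∑(cᵢ-dᵢ)}` (terms with `d ≰ c` vanish). -/
theorem B3_eq_B1 (m : ℕ) (b c : Fin (m + 3) → ℕ)
    (hb : StrictMono b) (hc : StrictMono c) (hb1 : ∀ i, 1 ≤ b i) (hc1 : ∀ i, 1 ≤ c i)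
    (hlast : b (Fin.last (m + 2)) = c (Fin.last (m + 2))) :
    B3fn m b c =
      ∑ d ∈ (Finset.Icc (fun _ => 1) c).filter
          (fun d => ∀ i j : Fin (m + 3), i < j → d i < d j),
        (Acoef (m + 3) d c : Polynomial ℚ) * braceT d b * (1 - X) ^ (∑ i, (c i - d i)) := by
  change _ = ∑ d ∈ TT c, _
  obtain ⟨N, hN⟩ : ∃ N, N = c (Fin.last (m + 2)) := ⟨_, rfl⟩
  have hcN : ∀ i, c i ≤ N := fun i => hN ▸ hc.monotone (Fin.le_last i)
  have hc' : StrictMono (fun j : Fin (m + 2) => c j.castSucc) :=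
    fun i j h => hc (by simpa using h)
  have hw : (1 - X : ℚ[X]) ≠ 0 := by
    intro h
    have := congrArg (Polynomial.eval 0) h
    simp at this
  have hR : (1 - X : ℚ[X]) ^ (∑ i, (N - c i)) * (∑ d ∈ TT c,
      (Acoef (m + 3) d c : ℚ[X]) * braceT d b * (1 - X) ^ (∑ i, (c i - d i))) =
      (Matrix.of fun j i => SS^[(Fin.rev j : ℕ)] (phi N (b i)) (c j)).det := by
    have K := Klem (m + 1) (Matrix.detRowAlternating (R := ℚ[X]) (n := Fin (m + 3)))
      (fun k i => phi N (b i) k) c hc hc1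
    have e : (Matrix.of fun j i => SS^[(Fin.rev j : ℕ)] (phi N (b i)) (c j)).det =
        Matrix.detRowAlternating (R := ℚ[X]) (n := Fin (m + 3))
          (fun j => SS^[(Fin.rev j : ℕ)] (fun k i => phi N (b i) k) (c j)) := by
      change Matrix.det _ = Matrix.det _
      congr 1
      funext j i
      rw [SS_iter_apply]
      rfl
    rw [e, ← K, Finset.mul_sum]
    apply Finset.sum_congr rfl
    intro d hd
    rw [mem_TT] at hd
    change _ = _ * (Matrix.of fun j i => (1 - X) ^ (N - d j) *
      (Matrix.of fun j i => brk (d j) (b i)) j i).det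
    rw [Matrix.det_mul_column, ← wprod N c d hd.2.1 hcN, braceT_det]
    ring
  have hL : (1 - X : ℚ[X]) ^ (∑ i : Fin (m + 2), (N - c i.castSucc)) * B3fn m b c =
      (Matrix.of fun (j i : Fin (m + 2)) =>
        SS^[(Fin.rev j : ℕ)] (psi N (b i.castSucc)) (c j.castSucc)).det := by
    have K := Klem m (Matrix.detRowAlternating (R := ℚ[X]) (n := Fin (m + 2)))
      (fun k i => psi N (b i.castSucc) k) _ hc' (fun i => hc1 _)
    have e : (Matrix.of fun (j i : Fin (m + 2)) =>
        SS^[(Fin.rev j : ℕ)] (psi N (b i.castSucc)) (c j.castSucc)).det =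
        Matrix.detRowAlternating (R := ℚ[X]) (n := Fin (m + 2))
          (fun j => SS^[(Fin.rev j : ℕ)] (fun k i => psi N (b i.castSucc) k)
            (c j.castSucc)) := by
      change Matrix.det _ = Matrix.det _
      congr 1
      funext j i
      rw [SS_iter_apply]
      rfl
    rw [e, ← K, B3fn, Finset.mul_sum]
    have hdet : ∀ d ∈ TT (fun j : Fin (m + 2) => c j.castSucc),
        (Acoef (m + 2) d (fun j => c j.castSucc) : ℚ[X]) *
          Matrix.detRowAlternating (R := ℚ[X]) (n := Fin (m + 2))
            (fun j i => psi N (b i.castSucc) (d j)) =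
        if ∀ j, b j.castSucc ≤ d j ∧ d j < b j.succ then
          (1 - X : ℚ[X]) ^ (∑ i : Fin (m + 2), (N - c i.castSucc)) *
          ((Acoef (m + 2) d (fun j => c j.castSucc) : ℚ[X]) *
            (1 - X) ^ (∑ j, (c j.castSucc - d j))) else 0 := by
      intro d hd
      rw [mem_TT] at hd
      change _ * (Matrix.of fun j i => (1 - X) ^ (N - d j) *
        (Matrix.of fun j (i : Fin (m + 2)) =>
          if b i.castSucc ≤ d j then (1 : ℚ[X]) else 0) j i).det = _
      rw [Matrix.det_mul_column, step_det d b hd.2.2 hb,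
        ← wprod N (fun j : Fin (m + 2) => c j.castSucc) d hd.2.1 (fun i => hcN _)]
      · split_ifs <;> ring
      · rw [hlast]
        exact (hd.2.1 _).trans_lt (hc (Fin.castSucc_lt_last _))
    rw [Finset.sum_congr rfl hdet, ← Finset.sum_filter]
    symm
    apply Finset.sum_subset
    · intro d hd
      rw [Finset.mem_filter] at hd
      rw [Finset.mem_Icc, Pi.le_def, Pi.le_def]
      refine ⟨fun i => (hd.2 i).1, fun i => ?_⟩
      have := (hd.2 i).2
      omega
    · intro d hd hd'
      rw [show Acoef (m + 2) d (fun j => c j.castSucc) = 0 from ?_]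
      · simp
      · by_contra h
        apply hd'
        rw [Finset.mem_Icc, Pi.le_def, Pi.le_def] at hd
        have h2 : ∀ j, d j < b j.succ := fun j => by
          have h3 := hd.2 j
          have h4 := hb1 j.succ
          omega
        rw [Finset.mem_filter, mem_TT]
        refine ⟨⟨fun i => (hb1 _).trans (hd.1 i), Acoef_le _ _ _ h, ?_⟩,
          fun j => ⟨hd.1 j, h2 j⟩⟩
        rw [Fin.strictMono_iff_lt_succ]
        intro i
        exact (h2 _).trans_le (hd.1 i.succ)
  have hD : (Matrix.of fun (j i : Fin (m + 3)) =>
      SS^[(Fin.rev j : ℕ)] (phi N (b i)) (c j)).det =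
      (Matrix.of fun (j i : Fin (m + 2)) =>
        SS^[(Fin.rev j : ℕ)] (psi N (b i.castSucc)) (c j.castSucc)).det := by
    rw [Matrix.det_succ_column _ (Fin.last (m + 2)), Fin.sum_univ_castSucc]
    rw [Finset.sum_eq_zero, zero_add]
    · have h1 : (-1 : ℚ[X]) ^ ((Fin.last (m + 2) : ℕ) + (Fin.last (m + 2) : ℕ)) = 1 :=
        Even.neg_one_pow ⟨_, rfl⟩
      have h2 : phi N (b (Fin.last (m + 2))) (c (Fin.last (m + 2))) = 1 := by
        simp [phi, brk, hlast, hN]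
      rw [h1, one_mul, Matrix.of_apply, Fin.rev_last]
      simp only [Fin.val_zero, Function.iterate_zero, id, h2, one_mul]
      congr 1
      funext j i
      simp only [Matrix.submatrix_apply, Matrix.of_apply, Fin.succAbove_last,
        Fin.rev_castSucc, Fin.val_succ, Function.iterate_succ, Function.comp]
      exact SS_iter_congr _ _ _ N (SS_phi N _ (hb1 _)) _ (hcN _)
    · intro j _
      have : SS^[(Fin.rev j.castSucc : ℕ)] (phi N (b (Fin.last (m + 2)))) (c j.castSucc)
          = 0 := by
        rw [SS_iter_congr _ _ (fun _ => 0) (c j.castSucc) ?_ _ le_rfl, SS_iter_zero]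
        intro k hk
        have := hc (Fin.castSucc_lt_last j)
        simp only [phi, brk]
        rw [if_neg (by omega), if_neg (by omega), mul_zero]
      rw [Matrix.of_apply, this]
      ring
  have hs : ∑ i, (N - c i) = ∑ i : Fin (m + 2), (N - c i.castSucc) := by
    rw [Fin.sum_univ_castSucc, ← hN]
    simp
  apply mul_left_cancel₀ (pow_ne_zero (∑ i, (N - c i)) hw)
  rw [hR, hD, hs, hL]
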